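/- arXiv:1603.02938 — 8 statements merged into one kernel-verified Lean document; each statement's English description precedes it below -/
import Mathlib

section
/- Let δ > 1 and 0 ≤ c < 1 be real numbers, and define f(t) = (t² + (1+δ)·c·t + δ) / ( √(t² + 2ct + 1) · √(t² + 2δct + δ²) ) for t ∈ ℝ (both radicands are strictly positive for all t). Then for every t > 0 one has f(t) ≥ (2√δ + (1+δ)c) / (1 + 2√δ·c + δ), with equality at t = √δ. -/
/-- For `δ > 1` and `0 ≤ c < 1`, the function
`f(t) = (t² + (1+δ)ct + δ)/(√(t²+2ct+1)·√(t²+2δct+δ²))` satisfies, for all `t > 0`,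
`f(t) ≥ (2√δ + (1+δ)c)/(1 + 2√δ c + δ)`, with equality at `t = √δ`. -/
theorem stmt_4 (δ c : ℝ) (hδ : 1 < δ) (hc0 : 0 ≤ c) (hc1 : c < 1)
    (f : ℝ → ℝ)
    (hf : ∀ t, f t = (t ^ 2 + (1 + δ) * c * t + δ) /
      (Real.sqrt (t ^ 2 + 2 * c * t + 1) * Real.sqrt (t ^ 2 + 2 * δ * c * t + δ ^ 2))) :
    (∀ t > 0, f t ≥ (2 * Real.sqrt δ + (1 + δ) * c) / (1 + 2 * Real.sqrt δ * c + δ)) ∧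
    f (Real.sqrt δ) = (2 * Real.sqrt δ + (1 + δ) * c) / (1 + 2 * Real.sqrt δ * c + δ) := by
  obtain ⟨s, hs, rfl⟩ : ∃ s : ℝ, 1 < s ∧ δ = s ^ 2 :=
    ⟨√δ, Real.lt_sqrt_of_sq_lt (by simpa using hδ), (Real.sq_sqrt (by linarith)).symm⟩
  have hs0 : 0 < s := by linarith
  rw [Real.sqrt_sq hs0.le]
  have hD : 0 < 1 + 2 * s * c + s ^ 2 := by positivity
  refine ⟨fun t ht => ?_, ?_⟩
  · have hA : 0 < t ^ 2 + 2 * c * t + 1 := by positivity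
    have hB : 0 < t ^ 2 + 2 * s ^ 2 * c * t + (s ^ 2) ^ 2 := by positivity
    have hM : 0 ≤ 2 * s + (1 + s ^ 2) * c := by positivity
    have hMN : (2 * s + (1 + s ^ 2) * c) * t ≤ t ^ 2 + (1 + s ^ 2) * c * t + s ^ 2 := by
      nlinarith [sq_nonneg (t - s)]
    have hsq : ((2 * s + (1 + s ^ 2) * c) * t) ^ 2 ≤
        (t ^ 2 + (1 + s ^ 2) * c * t + s ^ 2) ^ 2 :=
      pow_le_pow_left₀ (by positivity) hMN 2
    have hK : 0 ≤ (1 - c ^ 2) * (s ^ 2 - 1) ^ 2 :=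
      mul_nonneg (by nlinarith) (sq_nonneg _)
    rw [hf, ge_iff_le, ← Real.sqrt_mul hA.le,
      div_le_div_iff₀ hD (Real.sqrt_pos.2 (mul_pos hA hB))]
    refine abs_le_of_sq_le_sq' ?_ (by positivity) |>.2
    rw [mul_pow, Real.sq_sqrt (mul_pos hA hB).le]
    linear_combination mul_le_mul_of_nonneg_left hsq hK
  · have hB : s ^ 2 + 2 * s ^ 2 * c * s + (s ^ 2) ^ 2 = s ^ 2 * (s ^ 2 + 2 * c * s + 1) := by ring
    have hA : 0 < s ^ 2 + 2 * c * s + 1 := by positivity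
    rw [hf, hB, Real.sqrt_mul (sq_nonneg s), Real.sqrt_sq hs0.le, mul_left_comm,
      Real.mul_self_sqrt hA.le, div_eq_div_iff (mul_pos hs0 hA).ne' hD.ne']
    ring
end

section
/- Let δ > 1 and 0 ≤ c < 1 be real numbers, and define f(t) = (t² + (1+δ)·c·t + δ) / ( √(t² + 2ct + 1) · √(t² + 2δct + δ²) ) for t ∈ ℝ (both radicands are strictly positive for all t). Then for every real t one has f(t) ≥ (2√δ − (1+δ)c) / (1 − 2√δ·c + δ), with equality at t = −√δ. -/
/-- Monotonicity of `x ↦ x / √(x² + m)`, in homogeneous form: if `K|t| ≤ N`, `R² = N² + m t²` and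
`D² = K² + m`, then `K R ≤ N D`. -/
theorem mul_le_mul_of_sq_eq_sq_add {K N R D m t : ℝ} (hR : 0 ≤ R) (hD : 0 ≤ D) (hm : 0 ≤ m)
    (hR2 : R ^ 2 = N ^ 2 + m * t ^ 2) (hD2 : D ^ 2 = K ^ 2 + m) (h : K * |t| ≤ N) :
    K * R ≤ N * D := by
  have key : (N * D) ^ 2 - (K * R) ^ 2 = m * (N ^ 2 - (K * |t|) ^ 2) := by
    rw [mul_pow, mul_pow, mul_pow, hR2, hD2, sq_abs]
    ring
  rcases le_total 0 K with hK | hK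
  · have h0 : 0 ≤ K * |t| := by positivity
    have h1 : (K * |t|) ^ 2 ≤ N ^ 2 := pow_le_pow_left₀ h0 h 2
    refine le_of_abs_le (abs_le_of_sq_le_sq ?_ (mul_nonneg (h0.trans h) hD))
    nlinarith [mul_nonneg hm (sub_nonneg.2 h1)]
  · have hKR : K * R ≤ 0 := mul_nonpos_of_nonpos_of_nonneg hK hR
    rcases le_total 0 N with hN | hN
    · exact hKR.trans (mul_nonneg hN hD)
    · have h1 : N ^ 2 ≤ (K * |t|) ^ 2 := by nlinarith
      have h2 : (-(N * D)) ^ 2 ≤ (-(K * R)) ^ 2 := by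
        nlinarith [mul_nonneg hm (sub_nonneg.2 h1)]
      exact neg_le_neg_iff.1 (le_of_abs_le (abs_le_of_sq_le_sq h2 (neg_nonneg.2 hKR)))

/-- For `δ > 1` and `0 ≤ c < 1`, the function
`f(t) = (t² + (1+δ)ct + δ)/(√(t²+2ct+1)·√(t²+2δct+δ²))` satisfies, for all real `t`,
`f(t) ≥ (2√δ − (1+δ)c)/(1 − 2√δ c + δ)`, with equality at `t = −√δ`. -/
theorem stmt_5 (δ c : ℝ) (hδ : 1 < δ) (hc0 : 0 ≤ c) (hc1 : c < 1)
    (f : ℝ → ℝ)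
    (hf : ∀ t, f t = (t ^ 2 + (1 + δ) * c * t + δ) /
      (Real.sqrt (t ^ 2 + 2 * c * t + 1) * Real.sqrt (t ^ 2 + 2 * δ * c * t + δ ^ 2))) :
    (∀ t : ℝ, f t ≥ (2 * Real.sqrt δ - (1 + δ) * c) / (1 - 2 * Real.sqrt δ * c + δ)) ∧
    f (-Real.sqrt δ) = (2 * Real.sqrt δ - (1 + δ) * c) / (1 - 2 * Real.sqrt δ * c + δ) := by
  have hδ0 : 0 ≤ δ := by linarith
  obtain ⟨d, hd⟩ : ∃ d, d = Real.sqrt δ := ⟨_, rfl⟩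
  have hd0 : 0 < d := hd ▸ Real.sqrt_pos.2 (by linarith)
  have hdδ : δ = d ^ 2 := by rw [hd, Real.sq_sqrt hδ0]
  rw [← hd]
  clear hd
  subst hdδ
  have hm : 0 < 1 - c ^ 2 := by nlinarith
  have hD : 0 < 1 - 2 * d * c + d ^ 2 := by nlinarith [sq_nonneg (d - c)]
  have hP : ∀ t, 0 < t ^ 2 + 2 * c * t + 1 := fun t => by nlinarith [sq_nonneg (t + c)]
  have hQ : ∀ t, 0 < t ^ 2 + 2 * d ^ 2 * c * t + (d ^ 2) ^ 2 := fun t => by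
    nlinarith [sq_nonneg (t + d ^ 2 * c), mul_pos hm (pow_pos hd0 4)]
  refine ⟨fun t => ?_, ?_⟩
  · rw [hf, ge_iff_le, div_le_div_iff₀ hD
      (mul_pos (Real.sqrt_pos.2 (hP t)) (Real.sqrt_pos.2 (hQ t)))]
    refine mul_le_mul_of_sq_eq_sq_add (m := (1 - c ^ 2) * (d ^ 2 - 1) ^ 2) (t := t)
      (by positivity) hD.le (by positivity) ?_ (by ring) ?_
    · rw [mul_pow, Real.sq_sqrt (hP t).le, Real.sq_sqrt (hQ t).le]
      ring
    · have h1 : 0 ≤ (1 + d ^ 2) * c * (t + |t|) :=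
        mul_nonneg (by positivity) (by linarith [neg_abs_le t])
      nlinarith [sq_nonneg (|t| - d), sq_abs t]
  · have hQ' : (-d) ^ 2 + 2 * d ^ 2 * c * (-d) + (d ^ 2) ^ 2 =
        d ^ 2 * ((-d) ^ 2 + 2 * c * (-d) + 1) := by ring
    rw [hf, hQ', Real.sqrt_mul (sq_nonneg d), Real.sqrt_sq hd0.le, mul_left_comm,
      Real.mul_self_sqrt (hP (-d)).le,
      div_eq_div_iff (mul_pos hd0 (hP (-d))).ne' hD.ne']
    ring
end

section
/- Let λ, μ > 0 and α ∈ ℝ, and let A be the 2×2 real matrix A = R(α)·D, where R(α) is the rotation matrix with rows (cos α, −sin α) and (sin α, cos α), and D is the diagonal matrix diag(√λ, √μ). Then A has no real eigenvalue (equivalently, there is no real number r and nonzero vector v ∈ ℝ² with A·v = r·v) if and only if (√λ + √μ)·|cos α| < 2·(λμ)^{1/4}. -/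
/-- A real `2 × 2` matrix has a real eigenvalue iff the discriminant of its characteristic
polynomial is nonnegative. -/
theorem exists_mulVec_eq_smul_iff_discrim_nonneg (A : Matrix (Fin 2) (Fin 2) ℝ) :
    (∃ (r : ℝ) (v : Fin 2 → ℝ), v ≠ 0 ∧ A.mulVec v = r • v) ↔
      4 * A.det ≤ A.trace ^ 2 := by
  have key (r : ℝ) : (∃ v : Fin 2 → ℝ, v ≠ 0 ∧ A.mulVec v = r • v) ↔
      r ^ 2 - A.trace * r + A.det = 0 := by
    have hdet : (A - r • (1 : Matrix (Fin 2) (Fin 2) ℝ)).det =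
        r ^ 2 - A.trace * r + A.det := by
      simp [Matrix.det_fin_two, Matrix.trace_fin_two]
      ring
    rw [← hdet, ← Matrix.exists_mulVec_eq_zero_iff]
    simp only [Matrix.sub_mulVec, Matrix.smul_mulVec, Matrix.one_mulVec, sub_eq_zero]
  simp only [key]
  constructor
  · rintro ⟨r, hr⟩
    nlinarith [sq_nonneg (2 * r - A.trace)]
  · intro h
    refine ⟨(A.trace + √(A.trace ^ 2 - 4 * A.det)) / 2, ?_⟩
    linear_combination Real.sq_sqrt (sub_nonneg.2 h) / 4

/-- Let `A = R(α) · diag(√λ, √μ)` with `λ, μ > 0`. Then `A` has no real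
eigenvalue iff `(√λ + √μ)·|cos α| < 2·(λμ)^(1/4)`. -/
theorem stmt_6 (l m α : ℝ) (hl : 0 < l) (hm : 0 < m)
    (A : Matrix (Fin 2) (Fin 2) ℝ)
    (hA : A = Matrix.of ![![Real.cos α, -Real.sin α], ![Real.sin α, Real.cos α]] *
      Matrix.of ![![Real.sqrt l, 0], ![0, Real.sqrt m]]) :
    (¬ ∃ (r : ℝ) (v : Fin 2 → ℝ), v ≠ 0 ∧ A.mulVec v = r • v) ↔
      (Real.sqrt l + Real.sqrt m) * |Real.cos α| < 2 * (l * m) ^ ((1 : ℝ) / 4) := by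
  have htrace : A.trace = (√l + √m) * Real.cos α := by
    rw [hA]
    simp [Matrix.trace_fin_two]
    ring
  have hdet : A.det = √l * √m := by
    rw [hA, Matrix.det_mul, Matrix.det_fin_two_of, Matrix.det_fin_two_of]
    linear_combination √l * √m * Real.sin_sq_add_cos_sq α
  have hroot : ((l * m) ^ ((1 : ℝ) / 4)) ^ 2 = √l * √m := by
    rw [← Real.sqrt_mul hl.le, Real.sqrt_eq_rpow, ← Real.rpow_natCast,
      ← Real.rpow_mul (by positivity)]
    norm_num
  rw [exists_mulVec_eq_smul_iff_discrim_nonneg, not_le, htrace, hdet,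
    ← sq_lt_sq₀ (a := _ * |_|) (by positivity) (by positivity), mul_pow, mul_pow, mul_pow, sq_abs,
    hroot]
  norm_num
end

section
/- Let φ be a linear operator on the oriented Euclidean plane with no real eigenvalue: for every real number r and every nonzero vector x, φ(x) ≠ r·x. Then φ rotates all vectors in the same direction: either for every nonzero x the representative in (−π, π] of the signed angle oangle(x, φ(x)) is strictly positive, or for every nonzero x it is strictly negative. -/
instance : Fact (Module.finrank ℝ (EuclideanSpace ℝ (Fin 2)) = 2) :=
  ⟨finrank_euclideanSpace_fin⟩

/-- The standard orientation of the Euclidean plane. -/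
noncomputable def stdOrientation : Orientation ℝ (EuclideanSpace ℝ (Fin 2)) (Fin 2) :=
  (EuclideanSpace.basisFun (Fin 2) ℝ).toBasis.orientation

/-- On a preconnected set, a continuous real function without zeros has constant sign. -/
theorem IsPreconnected.forall_pos_or_forall_neg {X : Type*} [TopologicalSpace X] {s : Set X}
    (hs : IsPreconnected s) {f : X → ℝ} (hf : ContinuousOn f s) (h0 : ∀ x ∈ s, f x ≠ 0) :
    (∀ x ∈ s, 0 < f x) ∨ ∀ x ∈ s, f x < 0 := by
  by_contra! ⟨⟨x, hx, hfx⟩, y, hy, hfy⟩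
  obtain ⟨z, hz, hfz⟩ := hs.intermediate_value hx hy hf ⟨hfx, hfy⟩
  exact h0 z hz hfz

/-- The signed angle from `x` to `φ x` has constant sign when `φ` has no real eigenvalue. -/
theorem Orientation.forall_oangle_toReal_pos_or_forall_neg {V : Type*} [NormedAddCommGroup V]
    [InnerProductSpace ℝ V] [Fact (Module.finrank ℝ V = 2)] (o : Orientation ℝ V (Fin 2))
    (φ : V →ₗ[ℝ] V) (h : ∀ (r : ℝ) (x : V), x ≠ 0 → φ x ≠ r • x) :
    (∀ x : V, x ≠ 0 → 0 < (o.oangle x (φ x)).toReal) ∨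
      ∀ x : V, x ≠ 0 → (o.oangle x (φ x)).toReal < 0 := by
  have hfin : Module.finrank ℝ V = 2 := Fact.out
  have : FiniteDimensional ℝ V := .of_finrank_eq_succ hfin
  have hrank : 1 < Module.rank ℝ V := by
    rw [← Module.finrank_eq_rank, hfin]
    norm_num
  have hangle : ∀ x : V, x ≠ 0 → ¬(o.oangle x (φ x) = 0 ∨ o.oangle x (φ x) = Real.pi) := by
    intro x hx
    rw [o.oangle_eq_zero_or_eq_pi_iff_right_eq_smul]
    rintro (h0 | ⟨r, hr⟩)
    exacts [hx h0, h r x hx hr]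
  have hsin : ∀ x ∈ ({0}ᶜ : Set V), (o.oangle x (φ x)).sin ≠ 0 := fun x hx h0 =>
    hangle x hx (Real.Angle.sin_eq_zero_iff.1 h0)
  have hcont : ContinuousOn (fun x => (o.oangle x (φ x)).sin) {0}ᶜ := by
    refine fun x hx => ContinuousAt.continuousWithinAt ?_
    have hφx : φ x ≠ 0 := by simpa using h 0 x hx
    have hpair : ContinuousAt (fun y => (y, φ y)) x :=
      (continuous_id.prodMk φ.continuous_of_finiteDimensional).continuousAt
    have hoangle : ContinuousAt (fun y => o.oangle y (φ y)) x :=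
      ContinuousAt.comp (f := fun y => (y, φ y)) (g := fun p : V × V => o.oangle p.1 p.2)
        (o.continuousAt_oangle hx hφx) hpair
    exact Real.Angle.continuous_sin.continuousAt.comp hoangle
  refine ((isConnected_compl_singleton_of_one_lt_rank hrank
    (0 : V)).isPreconnected.forall_pos_or_forall_neg hcont hsin).imp
    (fun hpos x hx => ?_) fun hneg x hx => ?_
  · exact (Real.Angle.toReal_mem_Ioo_iff_sign_pos.2 (sign_eq_one_iff.2 (hpos x hx))).1
  · exact Real.Angle.toReal_neg_iff_sign_neg.2 (sign_eq_neg_one_iff.2 (hneg x hx))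

/-- An operator on the oriented Euclidean plane with no real eigenvalue rotates
all vectors in the same direction: either all signed angles `oangle x (φ x)`,
taken in `(−π, π]`, are positive, or all are negative. -/
theorem stmt_8 (φ : EuclideanSpace ℝ (Fin 2) →ₗ[ℝ] EuclideanSpace ℝ (Fin 2))
    (h : ∀ (r : ℝ) (x : EuclideanSpace ℝ (Fin 2)), x ≠ 0 → φ x ≠ r • x) :
    (∀ x : EuclideanSpace ℝ (Fin 2), x ≠ 0 →
      0 < (stdOrientation.oangle x (φ x)).toReal) ∨
    (∀ x : EuclideanSpace ℝ (Fin 2), x ≠ 0 →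
      (stdOrientation.oangle x (φ x)).toReal < 0) := by
  exact stdOrientation.forall_oangle_toReal_pos_or_forall_neg φ h
end

section
/- Let G' ⊂ ℝ⁴ be the set of points (x, y, z, t) with x² + y² < z² and z² + t² < 1. Then the Lebesgue measure (4-dimensional volume) of G' equals π²/4. -/
open MeasureTheory

/-- The area of a disc in `ℝ × ℝ`, given by its squared radius. -/
theorem volume_setOf_sq_add_sq_lt (R : ℝ) :
    volume {q : ℝ × ℝ | q.1 ^ 2 + q.2 ^ 2 < R} = ENNReal.ofReal (Real.pi * R) := by
  have hm : MeasurableSet {q : ℝ × ℝ | q.1 ^ 2 + q.2 ^ 2 < R} :=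
    measurableSet_lt (by fun_prop) (by fun_prop)
  rw [← Complex.volume_preserving_equiv_real_prod.measure_preimage hm.nullMeasurableSet]
  have h : Complex.measurableEquivRealProd ⁻¹' {q : ℝ × ℝ | q.1 ^ 2 + q.2 ^ 2 < R} =
      Metric.ball 0 (√R) := by
    ext z
    rw [mem_ball_zero_iff, Real.lt_sqrt (norm_nonneg z), Complex.sq_norm, Complex.normSq_apply]
    simp [Complex.measurableEquivRealProd_apply, sq]
  rw [h, Complex.volume_ball, ← ENNReal.ofReal_pow (Real.sqrt_nonneg R)]
  have hpi : (NNReal.pi : ENNReal) = ENNReal.ofReal Real.pi := by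
    rw [← NNReal.coe_real_pi, ENNReal.ofReal_coe_nnreal]
  rw [hpi, mul_comm, ← ENNReal.ofReal_mul Real.pi_pos.le]
  rcases le_total 0 R with hR | hR
  · rw [Real.sq_sqrt hR]
  · rw [Real.sqrt_eq_zero_of_nonpos hR, ENNReal.ofReal_of_nonpos (p := Real.pi * R)
      (mul_nonpos_of_nonneg_of_nonpos Real.pi_pos.le hR)]
    simp

/-- The second moment of the unit disc along the first axis. -/
theorem setLIntegral_unitDisc_sq_fst :
    ∫⁻ q in {q : ℝ × ℝ | q.1 ^ 2 + q.2 ^ 2 < 1}, ENNReal.ofReal (q.1 ^ 2) =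
      ENNReal.ofReal (Real.pi / 4) := by
  have hm : MeasurableSet {q : ℝ × ℝ | q.1 ^ 2 + q.2 ^ 2 < 1} :=
    measurableSet_lt (by fun_prop) (by fun_prop)
  have hradial : ∫⁻ r in Set.Ioo (0 : ℝ) 1, ENNReal.ofReal (r ^ 3) = ENNReal.ofReal (1 / 4) := by
    rw [← ofReal_integral_eq_lintegral_ofReal, ← integral_Ioc_eq_integral_Ioo,
      ← intervalIntegral.integral_of_le zero_le_one, integral_pow]
    · norm_num
    · exact (Continuous.integrableOn_Icc (by fun_prop)).mono_set Set.Ioo_subset_Icc_self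
    · filter_upwards [ae_restrict_mem measurableSet_Ioo] with r hr
      exact pow_nonneg hr.1.le 3
  have hangular : ∫⁻ θ in Set.Ioo (-Real.pi) Real.pi, ENNReal.ofReal (Real.cos θ ^ 2) =
      ENNReal.ofReal Real.pi := by
    rw [← ofReal_integral_eq_lintegral_ofReal, ← integral_Ioc_eq_integral_Ioo,
      ← intervalIntegral.integral_of_le (by linarith [Real.pi_pos]), integral_cos_sq]
    · simp
    · exact (Continuous.integrableOn_Icc (by fun_prop)).mono_set Set.Ioo_subset_Icc_self
    · exact Filter.Eventually.of_forall fun θ => sq_nonneg _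
  have hm' : MeasurableSet (Set.Ioo (0 : ℝ) 1 ×ˢ Set.Ioo (-Real.pi) Real.pi) :=
    measurableSet_Ioo.prod measurableSet_Ioo
  rw [← lintegral_indicator hm, ← lintegral_comp_polarCoord_symm,
    ← lintegral_indicator polarCoord.open_target.measurableSet]
  calc _ = ∫⁻ p in Set.Ioo (0 : ℝ) 1 ×ˢ Set.Ioo (-Real.pi) Real.pi,
        ENNReal.ofReal (p.1 ^ 3) * ENNReal.ofReal (Real.cos p.2 ^ 2) := by
        rw [← lintegral_indicator hm']
        congr 1
        ext ⟨r, θ⟩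
        have hn : (r * Real.cos θ) ^ 2 + (r * Real.sin θ) ^ 2 = r ^ 2 := by
          linear_combination r ^ 2 * Real.cos_sq_add_sin_sq θ
        simp only [Set.indicator_apply, polarCoord_target, Set.mem_prod, Set.mem_Ioi,
          Set.mem_Ioo, polarCoord_symm_apply, Set.mem_ofPred_eq, hn]
        by_cases hr : 0 < r
        · simp only [hr, sq_lt_one_iff₀ hr.le, true_and]
          by_cases h1 : r < 1 <;> simp only [h1, true_and, false_and, if_true, if_false]
          · rw [smul_eq_mul, ← ENNReal.ofReal_mul hr.le, ← ENNReal.ofReal_mul (by positivity)]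
            ring_nf
          · simp
        · simp [hr]
    _ = _ := by
        rw [Measure.volume_eq_prod, ← Measure.prod_restrict,
          lintegral_prod_mul (f := fun r : ℝ => ENNReal.ofReal (r ^ 3))
            (g := fun θ : ℝ => ENNReal.ofReal (Real.cos θ ^ 2)) (by fun_prop) (by fun_prop),
          hradial, hangular, ← ENNReal.ofReal_mul (by norm_num)]
        ring_nf

/-- The region `G' = {(x,y,z,t) : x² + y² < z², z² + t² < 1}` in `ℝ⁴` has
Lebesgue measure `π²/4`. -/
theorem stmt_9 :
    volume {p : ℝ × ℝ × ℝ × ℝ |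
        p.1 ^ 2 + p.2.1 ^ 2 < p.2.2.1 ^ 2 ∧ p.2.2.1 ^ 2 + p.2.2.2 ^ 2 < 1} =
      ENNReal.ofReal (Real.pi ^ 2 / 4) := by
  have hD : MeasurableSet {q : ℝ × ℝ | q.1 ^ 2 + q.2 ^ 2 < 1} :=
    measurableSet_lt (by fun_prop) (by fun_prop)
  have hG : MeasurableSet {p : ℝ × ℝ × ℝ × ℝ |
      p.1 ^ 2 + p.2.1 ^ 2 < p.2.2.1 ^ 2 ∧ p.2.2.1 ^ 2 + p.2.2.2 ^ 2 < 1} := by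
    rw [Set.ofPred_and]
    exact (measurableSet_lt (by fun_prop) (by fun_prop)).inter
      (measurableSet_lt (by fun_prop) (by fun_prop))
  have hassoc : MeasurePreserving
      (MeasurableEquiv.prodAssoc : (ℝ × ℝ) × (ℝ × ℝ) ≃ᵐ ℝ × ℝ × ℝ × ℝ) :=
    volume_preserving_prodAssoc
  rw [← hassoc.measure_preimage hG.nullMeasurableSet, Measure.volume_eq_prod,
    Measure.prod_apply_symm (hassoc.measurable hG)]
  calc _ = ∫⁻ q in {q : ℝ × ℝ | q.1 ^ 2 + q.2 ^ 2 < 1},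
        ENNReal.ofReal Real.pi * ENNReal.ofReal (q.1 ^ 2) := by
        rw [← lintegral_indicator hD]
        congr 1
        ext q
        rw [Set.indicator_apply]
        split_ifs with hq
        · rw [← ENNReal.ofReal_mul Real.pi_pos.le, ← volume_setOf_sq_add_sq_lt]
          congr 1
          ext p
          exact and_iff_left hq
        · refine measure_mono_null (fun p hp => hq hp.2) measure_empty
    _ = _ := by
        rw [lintegral_const_mul _ (by fun_prop), setLIntegral_unitDisc_sq_fst,
          ← ENNReal.ofReal_mul Real.pi_pos.le]
        ring_nf
end

section
/- Let G' ⊂ ℝ⁴ be the set of points (x, y, z, t) with x² + y² < z² and z² + t² < 1. Then the mean value over G' of the function γ'_max(x, y, z, t) = arcsin( √( (x² + y²) / (z² + t²) ) ), i.e. the Lebesgue integral of this function over G' divided by the measure of G', equals 2/π. Equivalently, ∫_{G'} arcsin( √( (x² + y²) / (z² + t²) ) ) dx dy dz dt = π/2. -/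
open MeasureTheory

open Real Set

theorem integral_radial (f : ℝ → ℝ) :
    ∫ v : ℝ × ℝ, f (v.1 ^ 2 + v.2 ^ 2) = 2 * π * ∫ r in Ioi (0 : ℝ), r * f (r ^ 2) := by
  rw [← integral_comp_polarCoord_symm]
  have h : ∀ p : ℝ × ℝ, p.1 • f ((polarCoord.symm p).1 ^ 2 + (polarCoord.symm p).2 ^ 2) =
      (p.1 * f (p.1 ^ 2)) * 1 := by
    intro p
    have : (p.1 * cos p.2) ^ 2 + (p.1 * sin p.2) ^ 2 = p.1 ^ 2 := by
      linear_combination p.1 ^ 2 * sin_sq_add_cos_sq p.2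
    simp [this]
  simp_rw [h]
  rw [polarCoord_target, Measure.volume_eq_prod,
    setIntegral_prod_mul (fun r : ℝ => r * f (r ^ 2)) (fun _ : ℝ => (1 : ℝ))]
  simp [pi_pos.le]
  ring

theorem integral_truncated_radial (g : ℝ → ℝ) (z : ℝ) {ρ : ℝ} (hρ : 0 < ρ) :
    ∫ v : ℝ × ℝ, (Iio (z ^ 2)).indicator (fun u => g (u / ρ ^ 2)) (v.1 ^ 2 + v.2 ^ 2) =
      2 * π * ρ ^ 2 * ∫ s in (0 : ℝ)..(|z| / ρ), s * g (s ^ 2) := by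
  rw [integral_radial]
  have h : ∀ r ∈ Ioi (0 : ℝ), r * (Iio (z ^ 2)).indicator (fun u => g (u / ρ ^ 2)) (r ^ 2) =
      (Iio |z|).indicator (fun r => ρ * ((r / ρ) * g ((r / ρ) ^ 2))) r := by
    intro r hr
    have : r ^ 2 < z ^ 2 ↔ r < |z| := by
      rw [sq_lt_sq, abs_of_pos hr]
    by_cases hz : r < |z|
    · rw [indicator_of_mem (mem_Iio.2 (this.2 hz)), indicator_of_mem (mem_Iio.2 hz), div_pow]
      field_simp
    · rw [indicator_of_notMem (mt (this.1 ∘ mem_Iio.1) hz),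
        indicator_of_notMem (mt mem_Iio.1 hz), mul_zero]
  rw [setIntegral_congr_fun measurableSet_Ioi h, setIntegral_indicator measurableSet_Iio,
    Ioi_inter_Iio, ← integral_Ioc_eq_integral_Ioo,
    ← intervalIntegral.integral_of_le (abs_nonneg z), intervalIntegral.integral_const_mul,
    intervalIntegral.integral_comp_div (fun s => s * g (s ^ 2)) hρ.ne', zero_div]
  simp only [smul_eq_mul]
  ring

theorem integral_abs_cos {h : ℝ → ℝ} (hh : Continuous h) :
    ∫ θ in (-π)..π, h |cos θ| = 4 * ∫ φ in (0 : ℝ)..(π / 2), h (sin φ) := by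
  have hi : ∀ a b : ℝ, IntervalIntegrable (fun θ => h |cos θ|) volume a b := fun a b =>
    (by fun_prop : Continuous fun θ => h |cos θ|).intervalIntegrable a b
  have hq : ∫ θ in (0 : ℝ)..(π / 2), h |cos θ| = ∫ φ in (0 : ℝ)..(π / 2), h (sin φ) := by
    have := intervalIntegral.integral_comp_sub_left (a := 0) (b := π / 2)
      (fun φ => h |sin φ|) (π / 2)
    simp only [sin_pi_div_two_sub, sub_self, sub_zero] at this
    rw [this]
    refine intervalIntegral.integral_congr fun φ hφ => ?_
    rw [uIcc_of_le (by positivity)] at hφ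
    rw [abs_of_nonneg (sin_nonneg_of_nonneg_of_le_pi hφ.1 (by linarith [hφ.2, pi_pos]))]
  have hr : ∫ θ in (π / 2)..π, h |cos θ| = ∫ θ in (0 : ℝ)..(π / 2), h |cos θ| := by
    have := intervalIntegral.integral_comp_sub_left (a := 0) (b := π / 2)
      (fun φ => h |cos φ|) π
    simp only [cos_pi_sub, abs_neg, sub_zero] at this
    rw [this]; congr 1; ring
  have hl : ∫ θ in (-π)..0, h |cos θ| = ∫ θ in (0 : ℝ)..π, h |cos θ| := by
    have := intervalIntegral.integral_comp_neg (a := 0) (b := π) (fun φ => h |cos φ|)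
    simp only [cos_neg, neg_zero] at this
    exact this.symm
  rw [← intervalIntegral.integral_add_adjacent_intervals (hi (-π) 0) (hi 0 π), hl,
    ← intervalIntegral.integral_add_adjacent_intervals (hi 0 (π / 2)) (hi (π / 2) π), hr, hq]
  ring

theorem integral_id_mul_arcsin {φ : ℝ} (h0 : 0 ≤ φ) (h1 : φ ≤ π / 2) :
    ∫ s in (0 : ℝ)..(sin φ), s * arcsin (√(s ^ 2)) =
      sin (2 * φ) / 8 - φ * cos (2 * φ) / 4 := by
  have hs0 : 0 ≤ sin φ := sin_nonneg_of_nonneg_of_le_pi h0 (by linarith [pi_pos])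
  rw [intervalIntegral.integral_eq_sub_of_hasDerivAt_of_le hs0
    (f := fun s => arcsin s * (2 * s ^ 2 - 1) / 4 + s * √(1 - s ^ 2) / 4)]
  · rw [arcsin_sin (by linarith [pi_pos]) h1, ← cos_sq',
      sqrt_sq (cos_nonneg_of_neg_pi_div_two_le_of_le (by linarith [pi_pos]) h1),
      sin_two_mul, cos_two_mul, cos_sq']
    simp
    ring
  · exact Continuous.continuousOn (by fun_prop)
  · intro s hs
    have hs1 : s < 1 := hs.2.trans_le (sin_le_one φ)
    have hp : 0 < 1 - s ^ 2 := by nlinarith [hs.1]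
    have hp' : 0 < √(1 - s ^ 2) := sqrt_pos.2 hp
    have d1 := hasDerivAt_arcsin (x := s) (by linarith [hs.1]) hs1.ne
    have d2 := ((hasDerivAt_pow 2 s).const_sub 1).sqrt hp.ne'
    have d3 := ((hasDerivAt_pow 2 s).const_mul 2).sub_const 1
    refine (((d1.mul d3).div_const 4).add
      (((hasDerivAt_id s).mul d2).div_const 4)).congr_deriv ?_
    rw [sqrt_sq hs.1.le]
    simp
    field_simp
    rw [sq_sqrt hp.le]
    ring
  · exact (by fun_prop : Continuous fun s => s * arcsin (√(s ^ 2))).intervalIntegrable _ _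

theorem integral_sin_two_mul_sub_mul_cos_two_mul : ∫ φ in (0 : ℝ)..(π / 2),
    (sin (2 * φ) / 8 - φ * cos (2 * φ) / 4) = 1 / 4 := by
  rw [intervalIntegral.integral_eq_sub_of_hasDerivAt
    (f := fun φ => -(φ * sin (2 * φ) / 8) - cos (2 * φ) / 8)]
  · rw [show 2 * (π / 2) = π by ring]; simp; norm_num
  · intro φ _
    have d0 := (hasDerivAt_id φ).const_mul 2
    have d1 := d0.sin
    have d2 := d0.cos
    refine ((((hasDerivAt_id φ).mul d1).div_const 8).neg.sub (d2.div_const 8)).congr_deriv ?_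
    simp only [id]
    ring
  · exact Continuous.intervalIntegrable (by fun_prop) _ _

/-- The set of points of ℝ⁴ with x² + y² < z² and z² + t² < 1. -/
def region : Set (ℝ × ℝ × ℝ × ℝ) :=
  {p | p.1 ^ 2 + p.2.1 ^ 2 < p.2.2.1 ^ 2 ∧ p.2.2.1 ^ 2 + p.2.2.2 ^ 2 < 1}

theorem measurableSet_region : MeasurableSet region := by
  rw [region, ofPred_and]
  exact (measurableSet_lt (by fun_prop) (by fun_prop)).inter
    (measurableSet_lt (by fun_prop) (by fun_prop))

theorem volume_region_lt_top : volume region < ⊤ := by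
  refine (measure_mono fun p hp => ?_).trans_lt
    (measure_ball_lt_top (x := (0 : ℝ × ℝ × ℝ × ℝ)) (r := 1))
  obtain ⟨h1, h2⟩ := hp
  simp only [mem_ball_zero_iff, Prod.norm_def, norm_eq_abs, max_lt_iff, ← sq_lt_one_iff_abs_lt_one]
  refine ⟨?_, ?_, ?_, ?_⟩ <;> nlinarith [sq_nonneg p.1, sq_nonneg p.2.1, sq_nonneg p.2.2.1,
    sq_nonneg p.2.2.2]

theorem integral_region {g : ℝ → ℝ} (hg : Continuous g) {C : ℝ} (hC : ∀ u, |g u| ≤ C) :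
    ∫ p in region, g ((p.1 ^ 2 + p.2.1 ^ 2) / (p.2.2.1 ^ 2 + p.2.2.2 ^ 2)) =
      2 * π * ∫ φ in (0 : ℝ)..(π / 2), ∫ s in (0 : ℝ)..(sin φ), s * g (s ^ 2) := by
  set F : ℝ × ℝ × ℝ × ℝ → ℝ := region.indicator
    fun p => g ((p.1 ^ 2 + p.2.1 ^ 2) / (p.2.2.1 ^ 2 + p.2.2.2 ^ 2)) with hF
  have hFi : Integrable F := by
    rw [hF, integrable_indicator_iff measurableSet_region]
    refine Measure.integrableOn_of_bounded (M := C) volume_region_lt_top.ne ?_ ?_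
    · exact (hg.measurable.comp (by fun_prop)).aestronglyMeasurable
    · exact ae_of_all _ fun p => hC _
  have hmp := volume_preserving_prodAssoc (α₁ := ℝ) (β₁ := ℝ) (γ₁ := ℝ × ℝ)
  rw [← integral_indicator measurableSet_region, ← hF, ← hmp.integral_comp']
  have hFi' := (hmp.integrable_comp_emb MeasurableEquiv.prodAssoc.measurableEmbedding).2 hFi
  rw [Measure.volume_eq_prod] at hFi' ⊢
  change ∫ q, (F ∘ MeasurableEquiv.prodAssoc) q ∂_ = _
  rw [integral_prod_symm _ hFi', ← integral_comp_polarCoord_symm]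
  set J : ℝ → ℝ := fun a => ∫ s in (0 : ℝ)..a, s * g (s ^ 2)
  have hJc : Continuous J := intervalIntegral.continuous_primitive
    (fun a b => Continuous.intervalIntegrable (by fun_prop) a b) 0
  have key : ∀ p ∈ polarCoord.target, p.1 • ∫ v : ℝ × ℝ,
      (F ∘ MeasurableEquiv.prodAssoc) (v, polarCoord.symm p) =
      (Iio 1).indicator (fun r => 2 * π * r ^ 3) p.1 * J |cos p.2| := by
    rintro ⟨ρ, θ⟩ hp
    have hρ : 0 < ρ := hp.1
    have hn : (ρ * cos θ) ^ 2 + (ρ * sin θ) ^ 2 = ρ ^ 2 := by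
      linear_combination ρ ^ 2 * sin_sq_add_cos_sq θ
    have hlt : ρ ^ 2 < 1 ↔ ρ < 1 := by rw [sq_lt_one_iff₀ hρ.le]
    simp only [polarCoord_symm_apply, smul_eq_mul]
    by_cases h1 : ρ < 1
    · have : ∀ v : ℝ × ℝ, (F ∘ MeasurableEquiv.prodAssoc) (v, (ρ * cos θ, ρ * sin θ)) =
          (Iio ((ρ * cos θ) ^ 2)).indicator (fun u => g (u / ρ ^ 2)) (v.1 ^ 2 + v.2 ^ 2) := by
        intro v
        simp [hF, indicator_apply, region, MeasurableEquiv.prodAssoc, hn, hlt, h1]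
      simp_rw [this]
      rw [integral_truncated_radial _ _ hρ, abs_mul, abs_of_pos hρ, mul_div_cancel_left₀ _ hρ.ne',
        indicator_of_mem (mem_Iio.2 h1)]
      ring
    · have : ∀ v : ℝ × ℝ,
          (F ∘ MeasurableEquiv.prodAssoc) (v, (ρ * cos θ, ρ * sin θ)) = 0 := by
        intro v
        simp [hF, region, MeasurableEquiv.prodAssoc, hn, hlt, h1]
      simp_rw [this]
      simp [h1]
  have h4 : ∫ r in Ioi (0 : ℝ), (Iio 1).indicator (fun r => 2 * π * r ^ 3) r = π / 2 := by
    rw [setIntegral_indicator measurableSet_Iio, Ioi_inter_Iio, ← integral_Ioc_eq_integral_Ioo,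
      ← intervalIntegral.integral_of_le zero_le_one, intervalIntegral.integral_const_mul,
      integral_pow]
    norm_num
    ring
  rw [setIntegral_congr_fun polarCoord.open_target.measurableSet key, polarCoord_target,
    Measure.volume_eq_prod, setIntegral_prod_mul _ (fun θ => J |cos θ|), h4,
    ← integral_Ioc_eq_integral_Ioo, ← intervalIntegral.integral_of_le (by linarith [pi_pos]),
    integral_abs_cos hJc]
  ring

theorem integral_region_arcsin :
    ∫ p in region, arcsin (√((p.1 ^ 2 + p.2.1 ^ 2) / (p.2.2.1 ^ 2 + p.2.2.2 ^ 2))) = π / 2 := by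
  rw [integral_region (g := fun u => arcsin (√u)) (by fun_prop)
    fun u => abs_le.2 ⟨neg_pi_div_two_le_arcsin _, arcsin_le_pi_div_two _⟩]
  rw [intervalIntegral.integral_congr (g := fun φ => sin (2 * φ) / 8 - φ * cos (2 * φ) / 4),
    integral_sin_two_mul_sub_mul_cos_two_mul]
  · ring
  · intro φ hφ
    rw [uIcc_of_le (by positivity)] at hφ
    exact integral_id_mul_arcsin hφ.1 hφ.2

theorem volume_region_toReal : (volume region).toReal = π ^ 2 / 4 := by
  have h := integral_region (g := fun _ => 1) continuous_const (C := 1) (by simp)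
  simp only [setIntegral_const, smul_eq_mul, mul_one, integral_id, Measure.real] at h
  rw [h]
  simp [intervalIntegral.integral_div, integral_sin_sq]
  ring

/-- Over the region `G' = {(x,y,z,t) : x² + y² < z², z² + t² < 1}` in `ℝ⁴`, the
integral of `arcsin √((x²+y²)/(z²+t²))` equals `π/2`; since the measure of `G'`
is `π²/4`, the mean value of this function over `G'` equals `2/π`. -/
theorem stmt_10
    (G' : Set (ℝ × ℝ × ℝ × ℝ))
    (hG' : G' = {p : ℝ × ℝ × ℝ × ℝ |
        p.1 ^ 2 + p.2.1 ^ 2 < p.2.2.1 ^ 2 ∧ p.2.2.1 ^ 2 + p.2.2.2 ^ 2 < 1}) :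
    (∫ p in G', Real.arcsin (Real.sqrt
        ((p.1 ^ 2 + p.2.1 ^ 2) / (p.2.2.1 ^ 2 + p.2.2.2 ^ 2))) ∂volume) =
      Real.pi / 2 ∧
    (∫ p in G', Real.arcsin (Real.sqrt
        ((p.1 ^ 2 + p.2.1 ^ 2) / (p.2.2.1 ^ 2 + p.2.2.2 ^ 2))) ∂volume) /
      (volume G').toReal = 2 / Real.pi := by
  subst hG'
  have hI := integral_region_arcsin
  have hV := volume_region_toReal
  rw [region] at hI hV
  refine ⟨hI, ?_⟩
  rw [hI, hV]
  field_simp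
  norm_num
end

section
/- Let G'⁺ ⊂ ℝ⁴ be the set of points (x, y, z, t) with x² + y² < z², z² + t² < 1, and z > 0. Then the Lebesgue integral ∫_{G'⁺} arccos( t / √(z² + t²) ) dx dy dz dt equals π³/16; since the measure of G'⁺ is π²/8, the mean value of α(x, y, z, t) = arccos( t / √(z² + t²) ) over G'⁺ equals π/2. -/
open MeasureTheory

/-- The area of a disc in `ℝ × ℝ` of radius `r`. -/
theorem volume_disc (r : ℝ) (hr : 0 ≤ r) :
    volume {p : ℝ × ℝ | p.1 ^ 2 + p.2 ^ 2 < r ^ 2} = ENNReal.ofReal (Real.pi * r ^ 2) := by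
  have hball : Complex.measurableEquivRealProd ⁻¹' {p : ℝ × ℝ | p.1 ^ 2 + p.2 ^ 2 < r ^ 2} =
      Metric.ball (0 : ℂ) r := by
    ext w
    simp only [Set.mem_preimage, Set.mem_ofPred_eq, Complex.measurableEquivRealProd_apply,
      mem_ball_zero_iff]
    rw [← sq_lt_sq₀ (norm_nonneg w) hr, Complex.sq_norm, Complex.normSq_apply, sq w.re, sq w.im]
  rw [← Complex.volume_preserving_equiv_real_prod.measure_preimage_equiv, hball,
    Complex.volume_ball, mul_comm, ENNReal.ofReal_mul Real.pi_pos.le, ENNReal.ofReal_pow hr]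
  congr 1
  rw [← NNReal.coe_real_pi, ENNReal.ofReal_coe_nnreal]

/-- The half disc `{(z, t) : z² + t² < 1, z > 0}`. -/
def halfDisc : Set (ℝ × ℝ) := {q | q.1 ^ 2 + q.2 ^ 2 < 1 ∧ 0 < q.1}

theorem measurableSet_halfDisc : MeasurableSet halfDisc := by
  rw [halfDisc, Set.ofPred_and]
  exact (measurableSet_lt (by fun_prop) (by fun_prop)).inter
    (measurableSet_lt (by fun_prop) (by fun_prop))

theorem integrableOn_halfDisc_sq :
    IntegrableOn (fun q : ℝ × ℝ => Real.pi * q.1 ^ 2) halfDisc := by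
  have hK : IsCompact (Set.Icc (-1 : ℝ) 1 ×ˢ Set.Icc (-1 : ℝ) 1) := isCompact_Icc.prod isCompact_Icc
  refine (ContinuousOn.integrableOn_compact hK (by fun_prop)).mono_set ?_
  rintro ⟨z, t⟩ ⟨h, hz⟩
  simp only at h hz
  refine ⟨⟨?_, ?_⟩, ⟨?_, ?_⟩⟩ <;> simp only <;> nlinarith [sq_nonneg z, sq_nonneg t]

theorem polarCoord_symm_mem_halfDisc_iff {p : ℝ × ℝ} (hp : p ∈ polarCoord.target) :
    polarCoord.symm p ∈ halfDisc ↔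
      p ∈ Set.Ioo (0 : ℝ) 1 ×ˢ Set.Ioo (-(Real.pi / 2)) (Real.pi / 2) := by
  obtain ⟨r, θ⟩ := p
  simp only [polarCoord_target, Set.mem_prod, Set.mem_Ioi, Set.mem_Ioo] at hp
  obtain ⟨hr, h1, h2⟩ := hp
  have hsq : (r * Real.cos θ) ^ 2 + (r * Real.sin θ) ^ 2 = r ^ 2 := by
    linear_combination r ^ 2 * Real.sin_sq_add_cos_sq θ
  simp only [halfDisc, Set.mem_ofPred_eq, polarCoord_symm_apply, Set.mem_prod, Set.mem_Ioo, hsq,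
    mul_pos_iff_of_pos_left hr, sq_lt_one_iff₀ hr.le, hr, true_and]
  refine and_congr_right fun _ => ⟨fun hc => ⟨?_, ?_⟩, fun h => Real.cos_pos_of_mem_Ioo h⟩
  · by_contra! h
    have := Real.cos_nonpos_of_pi_div_two_le_of_le (x := -θ) (by linarith) (by linarith)
    rw [Real.cos_neg] at this
    linarith
  · by_contra! h
    have := Real.cos_nonpos_of_pi_div_two_le_of_le h (by linarith)
    linarith

theorem setIntegral_halfDisc_sq :
    ∫ q in halfDisc, Real.pi * q.1 ^ 2 = Real.pi ^ 2 / 8 := by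
  have hpi := Real.pi_pos
  have hsub : Set.Ioo (0 : ℝ) 1 ×ˢ Set.Ioo (-(Real.pi / 2)) (Real.pi / 2) ⊆ polarCoord.target := by
    rw [polarCoord_target]
    exact Set.prod_mono (fun x hx => hx.1) (Set.Ioo_subset_Ioo (by linarith) (by linarith))
  rw [← integral_indicator measurableSet_halfDisc, ← integral_comp_polarCoord_symm]
  have hpolar : ∀ p ∈ polarCoord.target,
      p.1 • halfDisc.indicator (fun q : ℝ × ℝ => Real.pi * q.1 ^ 2) (polarCoord.symm p) =
        (Set.Ioo (0 : ℝ) 1 ×ˢ Set.Ioo (-(Real.pi / 2)) (Real.pi / 2)).indicator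
          (fun p : ℝ × ℝ => (Real.pi * p.1 ^ 3) * Real.cos p.2 ^ 2) p := by
    intro p hp
    have hiff := polarCoord_symm_mem_halfDisc_iff hp
    by_cases h : polarCoord.symm p ∈ halfDisc
    · rw [Set.indicator_of_mem h, Set.indicator_of_mem (hiff.1 h), polarCoord_symm_apply,
        smul_eq_mul]
      ring
    · rw [Set.indicator_of_notMem h, Set.indicator_of_notMem (mt hiff.2 h), smul_zero]
  rw [setIntegral_congr_fun polarCoord.open_target.measurableSet hpolar,
    setIntegral_indicator (measurableSet_Ioo.prod measurableSet_Ioo),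
    Set.inter_eq_right.2 hsub, Measure.volume_eq_prod,
    setIntegral_prod_mul (fun r : ℝ => Real.pi * r ^ 3) (fun θ => Real.cos θ ^ 2),
    ← integral_Ioc_eq_integral_Ioo, ← integral_Ioc_eq_integral_Ioo,
    ← intervalIntegral.integral_of_le zero_le_one,
    ← intervalIntegral.integral_of_le (by linarith), integral_cos_sq,
    intervalIntegral.integral_const_mul, integral_pow]
  simp
  ring

/-- The region `{(x, y, z, t) : x² + y² < z², z² + t² < 1, z > 0}`. -/
def coneRegion : Set (ℝ × ℝ × ℝ × ℝ) :=
  {p | p.1 ^ 2 + p.2.1 ^ 2 < p.2.2.1 ^ 2 ∧ p.2.2.1 ^ 2 + p.2.2.2 ^ 2 < 1 ∧ 0 < p.2.2.1}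

theorem measurableSet_coneRegion : MeasurableSet coneRegion := by
  rw [coneRegion, Set.ofPred_and, Set.ofPred_and]
  exact (measurableSet_lt (by fun_prop) (by fun_prop)).inter
    ((measurableSet_lt (by fun_prop) (by fun_prop)).inter
      (measurableSet_lt (by fun_prop) (by fun_prop)))

theorem volume_coneRegion : volume coneRegion = ENNReal.ofReal (Real.pi ^ 2 / 8) := by
  have hassoc : MeasurePreserving (MeasurableEquiv.prodAssoc : (ℝ × ℝ) × (ℝ × ℝ) ≃ᵐ _)
      volume volume := volume_preserving_prodAssoc
  have hslice : ∀ q : ℝ × ℝ,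
      volume ((fun w : ℝ × ℝ => (w, q)) ⁻¹' (MeasurableEquiv.prodAssoc ⁻¹' coneRegion)) =
        halfDisc.indicator (fun q : ℝ × ℝ => ENNReal.ofReal (Real.pi * q.1 ^ 2)) q := by
    intro q
    by_cases h : q ∈ halfDisc
    · rw [Set.indicator_of_mem h, ← volume_disc q.1 h.2.le]
      congr 1
      ext w
      exact and_iff_left h
    · rw [Set.indicator_of_notMem h]
      convert measure_empty (μ := (volume : Measure (ℝ × ℝ)))
      ext w
      exact iff_of_false (fun hw => h hw.2) id
  rw [← hassoc.measure_preimage_equiv, Measure.volume_eq_prod,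
    Measure.prod_apply_symm (MeasurableEquiv.prodAssoc.measurable measurableSet_coneRegion)]
  simp_rw [hslice]
  rw [lintegral_indicator measurableSet_halfDisc, ← ofReal_integral_eq_lintegral_ofReal
    integrableOn_halfDisc_sq (ae_of_all _ fun q => by positivity), setIntegral_halfDisc_sq]

theorem integrableOn_arccos {α : Type*} [MeasurableSpace α] {μ : Measure α} {s : Set α}
    (hs : μ s ≠ ⊤) {f : α → ℝ} (hf : Measurable f) :
    IntegrableOn (fun a => Real.arccos (f a)) s μ := by
  refine Measure.integrableOn_of_bounded (M := Real.pi) hs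
    (Real.continuous_arccos.measurable.comp hf).aestronglyMeasurable (ae_of_all _ fun a => ?_)
  rw [Real.norm_of_nonneg (Real.arccos_nonneg _)]
  exact Real.arccos_le_pi _

/-- If a measure preserving embedding preserves `s` and changes the sign of `f`,
then `arccos ∘ f` has mean `π / 2` on `s`. -/
theorem setIntegral_arccos_of_odd {α : Type*} [MeasurableSpace α] {μ : Measure α} {s : Set α}
    (hs : μ s ≠ ⊤) {f : α → ℝ} (hf : Measurable f) {e : α → α} (he : MeasurePreserving e μ μ)
    (he' : MeasurableEmbedding e) (hes : e ⁻¹' s = s) (hfe : ∀ a, f (e a) = -f a) :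
    ∫ a in s, Real.arccos (f a) ∂μ = Real.pi / 2 * (μ s).toReal := by
  have h := he.setIntegral_preimage_emb he' (fun a => Real.arccos (f a)) s
  simp only [hes, hfe, Real.arccos_neg] at h
  rw [integral_sub (integrable_const_iff.2 (Or.inr ⟨by simpa using hs.lt_top⟩)) (integrableOn_arccos hs hf), setIntegral_const,
    smul_eq_mul, measureReal_def] at h
  linarith

theorem setIntegral_coneRegion_arccos :
    ∫ p in coneRegion, Real.arccos (p.2.2.2 / Real.sqrt (p.2.2.1 ^ 2 + p.2.2.2 ^ 2)) =
      Real.pi / 2 * (volume coneRegion).toReal := by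
  let e : ℝ × ℝ × ℝ × ℝ ≃ᵐ ℝ × ℝ × ℝ × ℝ :=
    (MeasurableEquiv.refl ℝ).prodCongr ((MeasurableEquiv.refl ℝ).prodCongr
      ((MeasurableEquiv.refl ℝ).prodCongr (MeasurableEquiv.neg ℝ)))
  have he : MeasurePreserving e volume volume :=
    (MeasurePreserving.id volume).prod ((MeasurePreserving.id volume).prod
      ((MeasurePreserving.id volume).prod (Measure.measurePreserving_neg volume)))
  have happly : ∀ p, e p = (p.1, p.2.1, p.2.2.1, -p.2.2.2) := fun _ => rfl
  refine setIntegral_arccos_of_odd (by simp [volume_coneRegion]) (by fun_prop) he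
    e.measurableEmbedding ?_ fun p => ?_
  · ext p
    simp [coneRegion, happly]
  · simp [happly, neg_div]

/-- Over the region `G'⁺ = {(x,y,z,t) : x² + y² < z², z² + t² < 1, z > 0}` in
`ℝ⁴`, the integral of `arccos (t/√(z²+t²))` equals `π³/16`; the measure of
`G'⁺` is `π²/8`, so the mean value of this function over `G'⁺` equals `π/2`. -/
theorem stmt_11
    (Gp : Set (ℝ × ℝ × ℝ × ℝ))
    (hGp : Gp = {p : ℝ × ℝ × ℝ × ℝ |
        p.1 ^ 2 + p.2.1 ^ 2 < p.2.2.1 ^ 2 ∧ p.2.2.1 ^ 2 + p.2.2.2 ^ 2 < 1 ∧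
        0 < p.2.2.1}) :
    (∫ p in Gp, Real.arccos (p.2.2.2 /
        Real.sqrt (p.2.2.1 ^ 2 + p.2.2.2 ^ 2)) ∂volume) = Real.pi ^ 3 / 16 ∧
    volume Gp = ENNReal.ofReal (Real.pi ^ 2 / 8) ∧
    (∫ p in Gp, Real.arccos (p.2.2.2 /
        Real.sqrt (p.2.2.1 ^ 2 + p.2.2.2 ^ 2)) ∂volume) / (volume Gp).toReal =
      Real.pi / 2 := by
  have hmean := setIntegral_coneRegion_arccos
  rw [coneRegion, ← hGp] at hmean
  have hvol := volume_coneRegion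
  rw [coneRegion, ← hGp] at hvol
  have hreal : (volume Gp).toReal = Real.pi ^ 2 / 8 := by
    rw [hvol, ENNReal.toReal_ofReal (by positivity)]
  refine ⟨?_, hvol, ?_⟩
  · rw [hmean, hreal]
    ring
  · rw [hmean, mul_div_assoc, div_self (by rw [hreal]; positivity), mul_one]
end

section
/- Let A be a 2×2 real matrix with det A = 1 and |trace A| < 2, set θ = arccos(trace A / 2) ∈ (0, π), and assume θ/π is irrational. Let S be any symmetric positive definite 2×2 real matrix with Aᵀ·S·A = S, and let Q(x) = xᵀ·S·x. Then for every nonzero x ∈ ℝ², the orbit {Aⁿ·x : n ∈ ℕ} is dense in the ellipse {y ∈ ℝ² : Q(y) = Q(x)}. -/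
open Matrix

instance Real.Angle.instCompactSpace : CompactSpace Real.Angle :=
  haveI : Fact (0 < 2 * Real.pi) := ⟨Real.two_pi_pos⟩
  inferInstanceAs (CompactSpace (AddCircle (2 * Real.pi)))

/-- The natural multiples of an angle incommensurable with `π` are dense in the circle. -/
theorem Real.Angle.denseRange_nsmul_coe {θ : ℝ} (h : Irrational (θ / Real.pi)) :
    DenseRange (fun n : ℕ => n • (θ : Real.Angle)) := by
  have h2 : Irrational (θ / (2 * Real.pi)) := by
    have := h.div_natCast (m := 2) two_ne_zero
    rwa [div_div, mul_comm, Nat.cast_ofNat] at this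
  exact denseRange_zsmul_iff_nsmul.mp (AddCircle.denseRange_zsmul_coe_iff.mpr h2)

/-- De Moivre's formula for a matrix `J` with `J ^ 2 = -1`. -/
theorem Matrix.cos_smul_one_add_sin_smul_pow {J : Matrix (Fin 2) (Fin 2) ℝ} (hJ : J * J = -1)
    (θ : Real.Angle) (n : ℕ) :
    (θ.cos • (1 : Matrix (Fin 2) (Fin 2) ℝ) + θ.sin • J) ^ n =
      (n • θ).cos • (1 : Matrix (Fin 2) (Fin 2) ℝ) + (n • θ).sin • J := by
  induction n with
  | zero => simp
  | succ n ih =>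
    rw [pow_succ, ih, succ_nsmul, Real.Angle.cos_add, Real.Angle.sin_add]
    simp only [add_mul, mul_add, smul_mul_smul_comm, hJ, mul_one, one_mul]
    module

/-- A matrix of determinant one whose trace is `2 * cos θ` is `cos θ + sin θ * J`, where
`J ^ 2 = -1`. -/
theorem Matrix.exists_eq_cos_smul_one_add_sin_smul {A : Matrix (Fin 2) (Fin 2) ℝ}
    (hdet : A.det = 1) {θ : ℝ} (htr : A.trace = 2 * Real.cos θ) (hsin : Real.sin θ ≠ 0) :
    ∃ J : Matrix (Fin 2) (Fin 2) ℝ, J * J = -1 ∧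
      A = Real.cos θ • (1 : Matrix (Fin 2) (Fin 2) ℝ) + Real.sin θ • J := by
  refine ⟨(Real.sin θ)⁻¹ • (A - Real.cos θ • 1), ?_, ?_⟩
  · have hsq : (A - Real.cos θ • 1) * (A - Real.cos θ • 1) =
        -(Real.sin θ ^ 2) • (1 : Matrix (Fin 2) (Fin 2) ℝ) := by
      have hs := Real.sin_sq_add_cos_sq θ
      rw [det_fin_two] at hdet
      rw [trace_fin_two] at htr
      ext i j
      fin_cases i <;> fin_cases j <;> simp [mul_apply, Fin.sum_univ_two] <;> grind
    rw [smul_mul_smul_comm, hsq, smul_smul]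
    have : (Real.sin θ)⁻¹ * (Real.sin θ)⁻¹ * -(Real.sin θ ^ 2) = -1 := by field_simp
    rw [this, neg_one_smul]
  · rw [smul_inv_smul₀ hsin]
    abel

/-- If `J ^ 2 = -1` and `x ≠ 0`, then `x` and `J x` span the plane. -/
theorem Matrix.exists_eq_smul_add_smul_mulVec {J : Matrix (Fin 2) (Fin 2) ℝ} (hJ : J * J = -1)
    {x : Fin 2 → ℝ} (hx : x ≠ 0) (y : Fin 2 → ℝ) :
    ∃ a b : ℝ, y = a • x + b • J *ᵥ x := by
  have h00 := congr_fun₂ hJ 0 0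
  have h01 := congr_fun₂ hJ 0 1
  have h10 := congr_fun₂ hJ 1 0
  have h11 := congr_fun₂ hJ 1 1
  simp [mul_apply, Fin.sum_univ_two] at h00 h01 h10 h11
  have htr : J 1 1 = -J 0 0 := by
    have : J 0 1 ≠ 0 := by
      intro h
      rw [h] at h00
      nlinarith [sq_nonneg (J 0 0)]
    have : J 0 1 * (J 0 0 + J 1 1) = 0 := by linarith
    grind
  rw [htr] at h11
  have hd : x 0 * (J *ᵥ x) 1 - x 1 * (J *ᵥ x) 0 ≠ 0 := by
    intro hd
    simp [mulVec, dotProduct, Fin.sum_univ_two, htr] at hd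
    have hsq : (J 1 0 * x 0 - J 0 0 * x 1) ^ 2 + x 1 ^ 2 = 0 := by grind
    have hx1 : x 1 = 0 := by nlinarith [sq_nonneg (J 1 0 * x 0 - J 0 0 * x 1), sq_nonneg (x 1)]
    have hr : J 1 0 ≠ 0 := by
      intro h
      rw [h] at h00
      nlinarith [sq_nonneg (J 0 0)]
    have hx0 : x 0 = 0 := by
      rw [hx1] at hsq
      simpa [hr] using hsq
    apply hx
    ext i
    fin_cases i <;> simp [hx0, hx1]
  refine ⟨(y 0 * (J *ᵥ x) 1 - y 1 * (J *ᵥ x) 0) / (x 0 * (J *ᵥ x) 1 - x 1 * (J *ᵥ x) 0),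
    (x 0 * y 1 - x 1 * y 0) / (x 0 * (J *ᵥ x) 1 - x 1 * (J *ᵥ x) 0), ?_⟩
  ext i
  fin_cases i <;> simp only [Fin.zero_eta, Fin.mk_one, Pi.add_apply, Pi.smul_apply, smul_eq_mul] <;>
    rw [div_mul_eq_mul_div, div_mul_eq_mul_div, ← add_div, eq_div_iff hd] <;> ring

/-- If a quadratic form `y ↦ yᵀ S y` is constant and nonzero on `{cos φ • x + sin φ • v}`, then
the points `a • x + b • v` of the same level satisfy `a ^ 2 + b ^ 2 = 1`. -/
theorem Matrix.sq_add_sq_eq_one_of_forall_angle {S : Matrix (Fin 2) (Fin 2) ℝ} {x v : Fin 2 → ℝ}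
    (h : ∀ φ : Real.Angle, (φ.cos • x + φ.sin • v) ⬝ᵥ S *ᵥ (φ.cos • x + φ.sin • v) = x ⬝ᵥ S *ᵥ x)
    (hx : x ⬝ᵥ S *ᵥ x ≠ 0) {a b : ℝ}
    (hab : (a • x + b • v) ⬝ᵥ S *ᵥ (a • x + b • v) = x ⬝ᵥ S *ᵥ x) : a ^ 2 + b ^ 2 = 1 := by
  have hexp (a b : ℝ) : (a • x + b • v) ⬝ᵥ S *ᵥ (a • x + b • v) =
      a ^ 2 * (x ⬝ᵥ S *ᵥ x) + a * b * (x ⬝ᵥ S *ᵥ v + v ⬝ᵥ S *ᵥ x) + b ^ 2 * (v ⬝ᵥ S *ᵥ v) := by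
    simp only [mulVec_add, mulVec_smul, add_dotProduct, dotProduct_add, smul_dotProduct,
      dotProduct_smul, smul_eq_mul]
    ring
  have hv : v ⬝ᵥ S *ᵥ v = x ⬝ᵥ S *ᵥ x := by
    simpa using h ((Real.pi / 2 : ℝ) : Real.Angle)
  have hq := h ((Real.pi / 4 : ℝ) : Real.Angle)
  rw [Real.Angle.cos_coe, Real.Angle.sin_coe, Real.cos_pi_div_four, Real.sin_pi_div_four, hexp,
    hv] at hq
  rw [hexp, hv] at hab
  have h2 : (√2 : ℝ) ^ 2 = 2 := Real.sq_sqrt zero_le_two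
  have hB : x ⬝ᵥ S *ᵥ v + v ⬝ᵥ S *ᵥ x = 0 := by grind
  rw [hB] at hab
  exact mul_right_cancel₀ hx (by linarith)

/-- An isometry of a bilinear form preserves the associated quadratic form along its orbits. -/
theorem Matrix.pow_mulVec_dotProduct_mulVec {A S : Matrix (Fin 2) (Fin 2) ℝ} (h : Aᵀ * S * A = S)
    (x : Fin 2 → ℝ) (n : ℕ) :
    ((A ^ n) *ᵥ x) ⬝ᵥ S *ᵥ ((A ^ n) *ᵥ x) = x ⬝ᵥ S *ᵥ x := by
  induction n with
  | zero => simp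
  | succ n ih =>
    rw [← ih, pow_succ', ← mulVec_mulVec]
    nth_rewrite 2 [← h]
    rw [← mulVec_mulVec, ← mulVec_mulVec, dotProduct_mulVec _ Aᵀ, vecMul_transpose]

theorem Real.Angle.exists_cos_sin_eq {a b : ℝ} (h : a ^ 2 + b ^ 2 = 1) :
    ∃ φ : Real.Angle, φ.cos = a ∧ φ.sin = b := by
  have hn : ‖(⟨a, b⟩ : ℂ)‖ = 1 := by
    rw [Complex.norm_def, Complex.normSq_mk, ← pow_two, ← pow_two, h, Real.sqrt_one]
  have hz : (⟨a, b⟩ : ℂ) ≠ 0 := by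
    rw [← norm_ne_zero_iff, hn]
    exact one_ne_zero
  exact ⟨((⟨a, b⟩ : ℂ).arg : ℝ), by simp [Complex.cos_arg hz, hn], by simp [Complex.sin_arg, hn]⟩

/-- Let `A` be a real 2×2 matrix with `det A = 1` and `|trace A| < 2`, let
`θ = arccos (trace A / 2)` and assume `θ/π` is irrational. If `S` is symmetric
positive definite with `Aᵀ·S·A = S` and `Q(x) = xᵀ·S·x`, then for every nonzero
`x` the orbit `{Aⁿ·x : n ∈ ℕ}` is dense in the ellipse `{y : Q y = Q x}`. -/
theorem stmt_18 (A : Matrix (Fin 2) (Fin 2) ℝ)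
    (hdet : A.det = 1) (htr : |A.trace| < 2)
    (θ : ℝ) (hθ : θ = Real.arccos (A.trace / 2)) (hirr : Irrational (θ / Real.pi))
    (S : Matrix (Fin 2) (Fin 2) ℝ) (hS : S.PosDef) (hSA : Aᵀ * S * A = S) :
    ∀ x : Fin 2 → ℝ, x ≠ 0 →
      closure {y : Fin 2 → ℝ | ∃ n : ℕ, (A ^ n).mulVec x = y} =
        {y : Fin 2 → ℝ | y ⬝ᵥ S.mulVec y = x ⬝ᵥ S.mulVec x} := by
  intro x hx
  obtain ⟨hlo, hhi⟩ := abs_lt.mp htr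
  have hcos : A.trace = 2 * Real.cos θ := by
    rw [hθ, Real.cos_arccos (by linarith) (by linarith)]
    ring
  have hsin : Real.sin θ ≠ 0 := by
    rw [hθ]
    exact (Real.sin_pos_of_pos_of_lt_pi (Real.arccos_pos.mpr (by linarith))
      (Real.arccos_lt_pi.mpr (by linarith))).ne'
  obtain ⟨J, hJ, hA⟩ := exists_eq_cos_smul_one_add_sin_smul hdet hcos hsin
  let γ : Real.Angle → Fin 2 → ℝ := fun φ => φ.cos • x + φ.sin • J *ᵥ x
  have hγ : Continuous γ := (Real.Angle.continuous_cos.smul continuous_const).add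
    (Real.Angle.continuous_sin.smul continuous_const)
  have horbit : {y : Fin 2 → ℝ | ∃ n : ℕ, (A ^ n).mulVec x = y} =
      γ '' Set.range (fun n : ℕ => n • (θ : Real.Angle)) := by
    rw [← Set.range_comp]
    refine congrArg Set.range (funext fun n => ?_)
    rw [hA, ← Real.Angle.cos_coe, ← Real.Angle.sin_coe, cos_smul_one_add_sin_smul_pow hJ]
    simp [γ, add_mulVec, smul_mulVec]
  have hclosure : closure {y : Fin 2 → ℝ | ∃ n : ℕ, (A ^ n).mulVec x = y} = Set.range γ := by
    rw [horbit, hγ.isClosedMap.closure_image_eq_of_continuous hγ,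
      (Real.Angle.denseRange_nsmul_coe hirr).closure_range, Set.image_univ]
  have hsub : Set.range γ ⊆ {y : Fin 2 → ℝ | y ⬝ᵥ S.mulVec y = x ⬝ᵥ S.mulVec x} := by
    rw [← hclosure]
    refine closure_minimal ?_ (isClosed_eq (by fun_prop) continuous_const)
    rintro _ ⟨n, rfl⟩
    exact pow_mulVec_dotProduct_mulVec hSA x n
  rw [hclosure]
  refine hsub.antisymm fun y hy => ?_
  obtain ⟨a, b, rfl⟩ := exists_eq_smul_add_smul_mulVec hJ hx y
  have hpos : x ⬝ᵥ S *ᵥ x ≠ 0 := by simpa using (hS.dotProduct_mulVec_pos hx).ne'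
  obtain ⟨φ, rfl, rfl⟩ := Real.Angle.exists_cos_sin_eq
    (sq_add_sq_eq_one_of_forall_angle (fun φ => hsub ⟨φ, rfl⟩) hpos hy)
  exact ⟨φ, rfl⟩
end
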